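/- Let A denote the subalgebra of H(gl(1,1)) generated by x, y, u, v. An element z of H(gl(1,1)) is central if and only if there exist a, b ∈ A such that z = a + b·t, a is central in H(gl(1,1)), and b satisfies bx = xb, by = yb, bt = tb, bu = −ub and bv = −vb. -/

import Mathlib

open FreeAlgebra

noncomputable section

/-- The defining relations of the bosonization `H(gl(1,1))`: generators
`x = ι 0`, `y = ι 1`, `u = ι 2`, `v = ι 3`, `t = ι 4`. -/
inductive Hrel : FreeAlgebra ℂ (Fin 5) → FreeAlgebra ℂ (Fin 5) → Prop
  | xy : Hrel (ι ℂ 0 * ι ℂ 1) (ι ℂ 1 * ι ℂ 0)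
  | xu : Hrel (ι ℂ 0 * ι ℂ 2) (ι ℂ 2 * ι ℂ 0)
  | xv : Hrel (ι ℂ 0 * ι ℂ 3) (ι ℂ 3 * ι ℂ 0)
  | yu : Hrel (ι ℂ 1 * ι ℂ 2 - ι ℂ 2 * ι ℂ 1) (ι ℂ 2)
  | yv : Hrel (ι ℂ 1 * ι ℂ 3 - ι ℂ 3 * ι ℂ 1) (-ι ℂ 3)
  | uu : Hrel (ι ℂ 2 * ι ℂ 2) 0
  | vv : Hrel (ι ℂ 3 * ι ℂ 3) 0
  | uv : Hrel (ι ℂ 2 * ι ℂ 3 + ι ℂ 3 * ι ℂ 2) (ι ℂ 0)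
  | tt : Hrel (ι ℂ 4 * ι ℂ 4) 1
  | tx : Hrel (ι ℂ 4 * ι ℂ 0) (ι ℂ 0 * ι ℂ 4)
  | ty : Hrel (ι ℂ 4 * ι ℂ 1) (ι ℂ 1 * ι ℂ 4)
  | tu : Hrel (ι ℂ 4 * ι ℂ 2) (-(ι ℂ 2 * ι ℂ 4))
  | tv : Hrel (ι ℂ 4 * ι ℂ 3) (-(ι ℂ 3 * ι ℂ 4))

/-- The bosonization `H(gl(1,1))`, i.e. the free algebra modulo the two-sided
ideal generated by the relations. -/
abbrev Hgl : Type := RingQuot Hrel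

/-- The image of the generator `x` in `H(gl(1,1))`. -/
def hx : Hgl := RingQuot.mkAlgHom ℂ Hrel (ι ℂ 0)
/-- The image of the generator `y` in `H(gl(1,1))`. -/
def hy : Hgl := RingQuot.mkAlgHom ℂ Hrel (ι ℂ 1)
/-- The image of the generator `u` in `H(gl(1,1))`. -/
def hu : Hgl := RingQuot.mkAlgHom ℂ Hrel (ι ℂ 2)
/-- The image of the generator `v` in `H(gl(1,1))`. -/
def hv : Hgl := RingQuot.mkAlgHom ℂ Hrel (ι ℂ 3)
/-- The image of the generator `t` in `H(gl(1,1))`. -/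
def ht : Hgl := RingQuot.mkAlgHom ℂ Hrel (ι ℂ 4)

/-- `mul_neg` for the operations of `RingQuot`, whose `Mul` and `Neg` instances are too
opaque for `rw` and `simp` to apply the general lemma. -/
theorem Hgl.mul_neg (a b : Hgl) : a * -b = -(a * b) := _root_.mul_neg a b

/-- `neg_mul` for the operations of `RingQuot`. -/
theorem Hgl.neg_mul (a b : Hgl) : -a * b = -(a * b) := _root_.neg_mul a b

/-- A relation between elements of the free algebra holds between their images. -/
theorem mk_eq_of_rel {p q : FreeAlgebra ℂ (Fin 5)} (h : Hrel p q) :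
    RingQuot.mkAlgHom ℂ Hrel p = RingQuot.mkAlgHom ℂ Hrel q :=
  RingQuot.mkAlgHom_rel ℂ h

theorem hx_mul_hy : hx * hy = hy * hx := by
  simpa [hx, hy] using mk_eq_of_rel Hrel.xy

theorem hx_mul_hu : hx * hu = hu * hx := by
  simpa [hx, hu] using mk_eq_of_rel Hrel.xu

theorem hx_mul_hv : hx * hv = hv * hx := by
  simpa [hx, hv] using mk_eq_of_rel Hrel.xv

theorem hy_mul_hu_sub : hy * hu - hu * hy = hu := by
  simpa [hy, hu] using mk_eq_of_rel Hrel.yu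

theorem hy_mul_hv_sub : hy * hv - hv * hy = -hv := by
  simpa [hy, hv] using mk_eq_of_rel Hrel.yv

theorem hu_mul_hu : hu * hu = 0 := by
  simpa [hu] using mk_eq_of_rel Hrel.uu

theorem hv_mul_hv : hv * hv = 0 := by
  simpa [hv] using mk_eq_of_rel Hrel.vv

theorem hu_mul_hv_add : hu * hv + hv * hu = hx := by
  simpa [hu, hv, hx] using mk_eq_of_rel Hrel.uv

theorem ht_mul_ht : ht * ht = 1 := by
  simpa [ht] using mk_eq_of_rel Hrel.tt

theorem ht_mul_hx : ht * hx = hx * ht := by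
  simpa [ht, hx] using mk_eq_of_rel Hrel.tx

theorem ht_mul_hy : ht * hy = hy * ht := by
  simpa [ht, hy] using mk_eq_of_rel Hrel.ty

theorem ht_mul_hu : ht * hu = -(hu * ht) := by
  simpa [ht, hu] using mk_eq_of_rel Hrel.tu

theorem ht_mul_hv : ht * hv = -(hv * ht) := by
  simpa [ht, hv] using mk_eq_of_rel Hrel.tv

/-- A subalgebra containing the five generators is everything. -/
theorem mem_of_generators_mem (S : Subalgebra ℂ Hgl) (h0 : hx ∈ S) (h1 : hy ∈ S)
    (h2 : hu ∈ S) (h3 : hv ∈ S) (h4 : ht ∈ S) (z : Hgl) : z ∈ S := by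
  obtain ⟨w, rfl⟩ := RingQuot.mkAlgHom_surjective ℂ Hrel z
  induction w using FreeAlgebra.induction with
  | grade0 r => rw [AlgHom.commutes]; exact S.algebraMap_mem r
  | grade1 i => fin_cases i <;> assumption
  | mul p q hp hq => rw [map_mul]; exact S.mul_mem hp hq
  | add p q hp hq => rw [map_add]; exact S.add_mem hp hq

theorem mem_center_of_commute_generators {z : Hgl} (h0 : z * hx = hx * z)
    (h1 : z * hy = hy * z) (h2 : z * hu = hu * z) (h3 : z * hv = hv * z)
    (h4 : z * ht = ht * z) : z ∈ Subring.center Hgl := by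
  have key := mem_of_generators_mem (Subalgebra.centralizer ℂ {z})
  simp only [Subalgebra.mem_centralizer_iff, Set.mem_singleton_iff, forall_eq] at key
  exact Subring.mem_center_iff.2 fun g => (key h0 h1 h2 h3 h4 g).symm

/-- The algebra endomorphism fixing `x, y, u, v` and sending `t` to `-t`. -/
def negT : Hgl →ₐ[ℂ] Hgl :=
  RingQuot.liftAlgHom ℂ ⟨FreeAlgebra.lift ℂ ![hx, hy, hu, hv, -ht], by
    rintro _ _ (_ | _) <;>
      simp [hx_mul_hy, hx_mul_hu, hx_mul_hv, hy_mul_hu_sub, hy_mul_hv_sub, hu_mul_hu,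
        hv_mul_hv, hu_mul_hv_add, ht_mul_ht, ht_mul_hx, ht_mul_hy, ht_mul_hu, ht_mul_hv, Hgl.mul_neg,
        Hgl.neg_mul]⟩

theorem negT_hx : negT hx = hx := by simp [negT, hx]

theorem negT_hy : negT hy = hy := by simp [negT, hy]

theorem negT_hu : negT hu = hu := by simp [negT, hu]

theorem negT_hv : negT hv = hv := by simp [negT, hv]

theorem negT_ht : negT ht = -ht := by simp [negT, ht]

theorem negT_eq_self {a : Hgl} (ha : a ∈ Algebra.adjoin ℂ ({hx, hy, hu, hv} : Set Hgl)) :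
    negT a = a := by
  have hle : Algebra.adjoin ℂ ({hx, hy, hu, hv} : Set Hgl) ≤
      AlgHom.equalizer negT (AlgHom.id ℂ Hgl) := by
    rw [Algebra.adjoin_le_iff]
    rintro _ (rfl | rfl | rfl | rfl)
    exacts [negT_hx, negT_hy, negT_hu, negT_hv]
  exact hle ha

/-- Conjugation by `t` preserves the subalgebra generated by `x, y, u, v`. -/
theorem exists_ht_mul_eq {a : Hgl}
    (ha : a ∈ Algebra.adjoin ℂ ({hx, hy, hu, hv} : Set Hgl)) :
    ∃ c ∈ Algebra.adjoin ℂ ({hx, hy, hu, hv} : Set Hgl), ht * a = c * ht := by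
  induction ha using Algebra.adjoin_induction with
  | mem g hg =>
    have hmem := Algebra.subset_adjoin (R := ℂ) hg
    rcases hg with rfl | rfl | rfl | rfl
    · exact ⟨_, hmem, ht_mul_hx⟩
    · exact ⟨_, hmem, ht_mul_hy⟩
    · exact ⟨_, neg_mem hmem, by rw [ht_mul_hu, Hgl.neg_mul]⟩
    · exact ⟨_, neg_mem hmem, by rw [ht_mul_hv, Hgl.neg_mul]⟩
  | algebraMap r => exact ⟨_, Subalgebra.algebraMap_mem _ r, (Algebra.commutes r ht).symm⟩
  | add p q _ _ hp hq =>
    obtain ⟨c, hc, hpc⟩ := hp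
    obtain ⟨d, hd, hqd⟩ := hq
    exact ⟨c + d, add_mem hc hd, by rw [mul_add, add_mul, hpc, hqd]⟩
  | mul p q _ _ hp hq =>
    obtain ⟨c, hc, hpc⟩ := hp
    obtain ⟨d, hd, hqd⟩ := hq
    exact ⟨c * d, mul_mem hc hd, by rw [← mul_assoc, hpc, mul_assoc, hqd, mul_assoc]⟩

theorem exists_eq_add_mul_ht (z : Hgl) :
    ∃ a ∈ Algebra.adjoin ℂ ({hx, hy, hu, hv} : Set Hgl),
      ∃ b ∈ Algebra.adjoin ℂ ({hx, hy, hu, hv} : Set Hgl), z = a + b * ht := by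
  let A := Algebra.adjoin ℂ ({hx, hy, hu, hv} : Set Hgl)
  let S : Subalgebra ℂ Hgl :=
    { carrier := {z | ∃ a ∈ A, ∃ b ∈ A, z = a + b * ht}
      algebraMap_mem' := fun r => ⟨_, A.algebraMap_mem r, 0, A.zero_mem, by simp⟩
      add_mem' := by
        rintro _ _ ⟨a, ha, b, hb, rfl⟩ ⟨c, hc, d, hd, rfl⟩
        exact ⟨a + c, add_mem ha hc, b + d, add_mem hb hd, by rw [add_mul]; abel⟩
      mul_mem' := by
        rintro _ _ ⟨a, ha, b, hb, rfl⟩ ⟨c, hc, d, hd, rfl⟩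
        obtain ⟨c', hc', hcc⟩ := exists_ht_mul_eq hc
        obtain ⟨d', hd', hdd⟩ := exists_ht_mul_eq hd
        refine ⟨a * c + b * d', add_mem (mul_mem ha hc) (mul_mem hb hd'),
          a * d + b * c', add_mem (mul_mem ha hd) (mul_mem hb hc'), ?_⟩
        have h1 : b * ht * c = b * c' * ht := by rw [mul_assoc, hcc, mul_assoc]
        have h2 : b * ht * (d * ht) = b * d' := by
          rw [mul_assoc, ← mul_assoc ht, hdd, mul_assoc d', ht_mul_ht, mul_one]
        rw [add_mul, mul_add, mul_add, h1, h2, add_mul, mul_assoc a d]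
        abel }
  have gen {g : Hgl} (hg : g ∈ ({hx, hy, hu, hv} : Set Hgl)) : g ∈ S :=
    ⟨g, Algebra.subset_adjoin hg, 0, A.zero_mem, by simp⟩
  exact mem_of_generators_mem S (gen (by simp)) (gen (by simp)) (gen (by simp))
    (gen (by simp)) ⟨0, A.zero_mem, 1, A.one_mem, by simp⟩ z

theorem eq_of_add_eq_of_add_neg_eq {M : Type*} [AddCommGroup M] [Module ℂ M] {p q r s : M}
    (h1 : p + q = r + s) (h2 : p + -q = r + -s) : p = r := by
  apply smul_right_injective M (two_ne_zero (α := ℂ))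
  simp only [two_smul]
  calc p + p = (p + q) + (p + -q) := by abel
    _ = r + r := by rw [h1, h2]; abel

/-- Both components of a central element commute with every eigenvector of `negT`
for the eigenvalues `1` and `-1`. -/
theorem components_commute {a b g : Hgl}
    (ha : a ∈ Algebra.adjoin ℂ ({hx, hy, hu, hv} : Set Hgl))
    (hb : b ∈ Algebra.adjoin ℂ ({hx, hy, hu, hv} : Set Hgl))
    (hz : a + b * ht ∈ Subring.center Hgl) (hg : negT g = g ∨ negT g = -g) :
    a * g = g * a ∧ b * ht * g = g * (b * ht) := by
  have h1 : (a + b * ht) * g = g * (a + b * ht) := (Subring.mem_center_iff.1 hz g).symm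
  have h2 : (a + -(b * ht)) * g = g * (a + -(b * ht)) := by
    have h := congrArg negT h1
    simp only [map_mul, map_add, negT_eq_self ha, negT_eq_self hb, negT_ht, Hgl.mul_neg] at h
    rcases hg with hg | hg
    · simpa only [hg] using h
    · simpa only [hg, Hgl.neg_mul, Hgl.mul_neg, neg_inj] using h
  rw [mul_add, add_mul] at h1 h2
  rw [Hgl.mul_neg, Hgl.neg_mul] at h2
  have h3 : a * g = g * a := eq_of_add_eq_of_add_neg_eq h1 h2
  rw [h3] at h1
  exact ⟨h3, add_left_cancel h1⟩

/-- Characterization of the center of `H(gl(1,1))`: with `A` the subalgebra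
generated by `x, y, u, v`, an element `z` is central iff `z = a + b·t` with
`a, b ∈ A`, `a` central, and `b` commuting with `x`, `y`, `t` and
anticommuting with `u`, `v`. -/
theorem stmt_11 :
    let A := Algebra.adjoin ℂ ({hx, hy, hu, hv} : Set Hgl)
    ∀ z : Hgl, z ∈ Subring.center Hgl ↔
      ∃ a ∈ A, ∃ b ∈ A, z = a + b * ht ∧ a ∈ Subring.center Hgl ∧
        b * hx = hx * b ∧ b * hy = hy * b ∧ b * ht = ht * b ∧
        b * hu = -(hu * b) ∧ b * hv = -(hv * b) := by
  intro A z
  have cancel {p q : Hgl} (h : p * ht = q * ht) : p = q := by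
    simpa [mul_assoc, ht_mul_ht] using congrArg (· * ht) h
  constructor
  · intro hz
    obtain ⟨a, ha, b, hb, rfl⟩ := exists_eq_add_mul_ht z
    obtain ⟨ax, bx⟩ := components_commute ha hb hz (Or.inl negT_hx)
    obtain ⟨ay, b_y⟩ := components_commute ha hb hz (Or.inl negT_hy)
    obtain ⟨au, bu⟩ := components_commute ha hb hz (Or.inl negT_hu)
    obtain ⟨av, bv⟩ := components_commute ha hb hz (Or.inl negT_hv)
    obtain ⟨a_t, bt⟩ := components_commute ha hb hz (Or.inr negT_ht)
    rw [mul_assoc, ht_mul_hx, ← mul_assoc, ← mul_assoc] at bx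
    rw [mul_assoc, ht_mul_hy, ← mul_assoc, ← mul_assoc] at b_y
    rw [mul_assoc, ht_mul_hu, Hgl.mul_neg, neg_eq_iff_eq_neg, ← mul_assoc, ← mul_assoc,
      ← Hgl.neg_mul] at bu
    rw [mul_assoc, ht_mul_hv, Hgl.mul_neg, neg_eq_iff_eq_neg, ← mul_assoc, ← mul_assoc,
      ← Hgl.neg_mul] at bv
    rw [← mul_assoc ht] at bt
    exact ⟨a, ha, b, hb, rfl, mem_center_of_commute_generators ax ay au av a_t,
      cancel bx, cancel b_y, cancel bt, cancel bu, cancel bv⟩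
  · rintro ⟨a, -, b, -, rfl, ha, bx, b_y, bt, bu, bv⟩
    refine add_mem ha (mem_center_of_commute_generators ?_ ?_ ?_ ?_ ?_)
    · rw [mul_assoc, ht_mul_hx, ← mul_assoc, bx, mul_assoc]
    · rw [mul_assoc, ht_mul_hy, ← mul_assoc, b_y, mul_assoc]
    · rw [mul_assoc, ht_mul_hu, Hgl.mul_neg, ← mul_assoc, bu, Hgl.neg_mul, neg_neg, mul_assoc]
    · rw [mul_assoc, ht_mul_hv, Hgl.mul_neg, ← mul_assoc, bv, Hgl.neg_mul, neg_neg, mul_assoc]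
    · rw [← mul_assoc, bt]
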